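/- arXiv:2209.04878 — 7 statements merged into one kernel-verified Lean document; each statement's English description precedes it below -/
import Mathlib

section
/- Let ℏ > 0, let H : ℝ² → ℝ be smooth, and let χ : ℝ × ℝ² → ℂ be smooth and satisfy the Koopman–von Neumann equation iℏ ∂ₜχ(t,q,p) = iℏ {H, χ(t,·)}(q,p) for all (t,q,p). Then the density ρ(t,q,p) := |χ(t,q,p)|² satisfies the classical Liouville equation ∂ₜρ(t,q,p) = {H, ρ(t,·)}(q,p) for all (t,q,p). -/
open Complex MeasureTheory ComplexConjugate

/-- Partial derivative in `q` (first coordinate) of a complex-valued phase-space function. -/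
noncomputable def dq (f : ℝ × ℝ → ℂ) (z : ℝ × ℝ) : ℂ :=
  deriv (fun q : ℝ => f (q, z.2)) z.1

/-- Partial derivative in `p` (second coordinate) of a complex-valued phase-space function. -/
noncomputable def dp (f : ℝ × ℝ → ℂ) (z : ℝ × ℝ) : ℂ :=
  deriv (fun p : ℝ => f (z.1, p)) z.2

/-- Partial derivative in `q` of a real-valued phase-space function. -/
noncomputable def dqR (f : ℝ × ℝ → ℝ) (z : ℝ × ℝ) : ℝ :=
  deriv (fun q : ℝ => f (q, z.2)) z.1

/-- Partial derivative in `p` of a real-valued phase-space function. -/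
noncomputable def dpR (f : ℝ × ℝ → ℝ) (z : ℝ × ℝ) : ℝ :=
  deriv (fun p : ℝ => f (z.1, p)) z.2

/-- Canonical Poisson bracket of a real function with a complex function:
`{H, f} = ∂_q H ∂_p f − ∂_p H ∂_q f`. -/
noncomputable def pb (H : ℝ × ℝ → ℝ) (f : ℝ × ℝ → ℂ) (z : ℝ × ℝ) : ℂ :=
  (dqR H z : ℂ) * dp f z - (dpR H z : ℂ) * dq f z

/-- Canonical Poisson bracket of two real functions. -/
noncomputable def pbR (H f : ℝ × ℝ → ℝ) (z : ℝ × ℝ) : ℝ :=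
  dqR H z * dpR f z - dpR H z * dqR f z

/-- Canonical Poisson bracket of two complex functions. -/
noncomputable def pbC (f g : ℝ × ℝ → ℂ) (z : ℝ × ℝ) : ℂ :=
  dq f z * dp g z - dp f z * dq g z

/-- The derivative of `|f|²` along a real curve is `2 Re (conj f · f')`, written in coordinates. -/
theorem deriv_normSq_comp {f : ℝ → ℂ} {x : ℝ} (hf : DifferentiableAt ℝ f x) :
    deriv (fun s => Complex.normSq (f s)) x
      = 2 * ((f x).re * (deriv f x).re + (f x).im * (deriv f x).im) := by
  have hre : HasDerivAt (fun s => (f s).re) (deriv f x).re x :=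
    Complex.reCLM.hasFDerivAt.comp_hasDerivAt x hf.hasDerivAt
  have him : HasDerivAt (fun s => (f s).im) (deriv f x).im x :=
    Complex.imCLM.hasFDerivAt.comp_hasDerivAt x hf.hasDerivAt
  simp only [Complex.normSq_apply]
  rw [((hre.fun_mul hre).fun_add (him.fun_mul him)).deriv]
  ring

/-- If `χ` satisfies the Koopman–von Neumann equation
`iℏ ∂ₜχ = iℏ {H, χ}`, then `ρ = |χ|²` satisfies the classical Liouville
equation `∂ₜρ = {H, ρ}`. -/
theorem kvn_implies_liouville (ℏ : ℝ) (hℏ : 0 < ℏ)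
    (H : ℝ × ℝ → ℝ) (hH : ContDiff ℝ (⊤ : ℕ∞) H)
    (χ : ℝ → ℝ × ℝ → ℂ)
    (hχ : ContDiff ℝ (⊤ : ℕ∞) (fun tz : ℝ × (ℝ × ℝ) => χ tz.1 tz.2))
    (hKvN : ∀ (t : ℝ) (z : ℝ × ℝ),
      Complex.I * (ℏ : ℂ) * deriv (fun s => χ s z) t
        = Complex.I * (ℏ : ℂ) * pb H (χ t) z) :
    ∀ (t : ℝ) (z : ℝ × ℝ),
      deriv (fun s => Complex.normSq (χ s z)) t
        = pbR H (fun w => Complex.normSq (χ t w)) z := by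
  intro t z
  have hd : Differentiable ℝ (fun tz : ℝ × (ℝ × ℝ) => χ tz.1 tz.2) :=
    hχ.differentiable (by simp)
  have ht : DifferentiableAt ℝ (fun s => χ s z) t :=
    hd.differentiableAt.comp t (f := fun s : ℝ => (s, z)) (by fun_prop)
  have hq : DifferentiableAt ℝ (fun q => χ t (q, z.2)) z.1 :=
    hd.differentiableAt.comp z.1 (f := fun q : ℝ => (t, (q, z.2))) (by fun_prop)
  have hp : DifferentiableAt ℝ (fun p => χ t (z.1, p)) z.2 :=
    hd.differentiableAt.comp z.2 (f := fun p : ℝ => (t, (z.1, p))) (by fun_prop)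
  have hIℏ : Complex.I * (ℏ : ℂ) ≠ 0 :=
    mul_ne_zero Complex.I_ne_zero (Complex.ofReal_ne_zero.mpr hℏ.ne')
  have hKvN' : deriv (fun s => χ s z) t = pb H (χ t) z :=
    mul_left_cancel₀ hIℏ (hKvN t z)
  have hρq : dqR (fun w => Complex.normSq (χ t w)) z
      = 2 * ((χ t z).re * (dq (χ t) z).re + (χ t z).im * (dq (χ t) z).im) :=
    deriv_normSq_comp hq
  have hρp : dpR (fun w => Complex.normSq (χ t w)) z
      = 2 * ((χ t z).re * (dp (χ t) z).re + (χ t z).im * (dp (χ t) z).im) :=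
    deriv_normSq_comp hp
  rw [deriv_normSq_comp ht, hKvN', pbR, hρq, hρp, pb]
  simp only [Complex.sub_re, Complex.sub_im, Complex.re_ofReal_mul, Complex.im_ofReal_mul]
  ring
end

section
/- Let ℏ > 0, let H : ℝ² → ℝ be smooth, let D : ℝ × ℝ² → ℝ be smooth with D(t,z) > 0 for all (t,z), let S : ℝ × ℝ² → ℝ be smooth, and set χ(t,z) := √(D(t,z)) · exp(i S(t,z)/ℏ). Then χ satisfies the Koopman–van Hove equation iℏ ∂ₜχ = iℏ {H, χ} − (p ∂_p H − H) χ if and only if D satisfies the transport equation ∂ₜD = {H, D} and S satisfies the phase-space Hamilton–Jacobi equation ∂ₜS = {H, S} + p ∂_p H − H (i.e. dD/dt = 0 and dS/dt = L, the Lagrangian L = p ∂_p H − H, along the Hamiltonian flow (q̇, ṗ) = (∂_p H, −∂_q H)). -/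
open Complex MeasureTheory ComplexConjugate

/-- The derivative of `√d e^{is/ℏ}` along a real parameter is `(d' / (2d) + i s' / ℏ)` times it. -/
theorem deriv_sqrt_mul_cexp (ℏ : ℝ) {d s : ℝ → ℝ} {x : ℝ} (hd : DifferentiableAt ℝ d x)
    (hs : DifferentiableAt ℝ s x) (hpos : 0 < d x) :
    deriv (fun y => (Real.sqrt (d y) : ℂ) * Complex.exp (Complex.I * (s y : ℂ) / (ℏ : ℂ))) x
      = (Real.sqrt (d x) : ℂ) * Complex.exp (Complex.I * (s x : ℂ) / (ℏ : ℂ))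
        * (((deriv d x : ℝ) : ℂ) / (2 * (d x : ℂ)) + Complex.I * ((deriv s x : ℝ) : ℂ) / (ℏ : ℂ)) := by
  have hsqrt := (hd.hasDerivAt.sqrt hpos.ne').ofReal_comp
  have hexp := ((hs.hasDerivAt.ofReal_comp.const_mul Complex.I).div_const (ℏ : ℂ)).cexp
  refine (hsqrt.mul hexp).deriv.trans ?_
  have hr : (Real.sqrt (d x) : ℂ) ≠ 0 := by
    exact_mod_cast (Real.sqrt_pos.mpr hpos).ne'
  have hsq : (d x : ℂ) = (Real.sqrt (d x) : ℂ) ^ 2 := by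
    exact_mod_cast (Real.sq_sqrt hpos.le).symm
  rw [hsq]
  push_cast
  field_simp

/-- A complex equation `c w (a / 2d + i b / ℏ) = …` with `c = iℏ` splits into its real and
imaginary parts once the nonzero factor `w` is cancelled. -/
theorem polar_equation_iff {ℏ d : ℝ} (hℏ : 0 < ℏ) (hd : 0 < d) {w : ℂ} (hw : w ≠ 0)
    (a b hq hp aq ap bq bp L : ℝ) :
    (Complex.I * (ℏ : ℂ) * (w * ((a : ℂ) / (2 * (d : ℂ)) + Complex.I * (b : ℂ) / (ℏ : ℂ)))
      = Complex.I * (ℏ : ℂ)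
          * ((hq : ℂ) * (w * ((ap : ℂ) / (2 * (d : ℂ)) + Complex.I * (bp : ℂ) / (ℏ : ℂ)))
            - (hp : ℂ) * (w * ((aq : ℂ) / (2 * (d : ℂ)) + Complex.I * (bq : ℂ) / (ℏ : ℂ))))
        - (L : ℂ) * w)
    ↔ a = hq * ap - hp * aq ∧ b = hq * bp - hp * bq + L := by
  have hℏ' : (ℏ : ℂ) ≠ 0 := by exact_mod_cast hℏ.ne'
  have hd' : (d : ℂ) ≠ 0 := by exact_mod_cast hd.ne'
  have key : Complex.I * (ℏ : ℂ)
          * (w * ((a : ℂ) / (2 * (d : ℂ)) + Complex.I * (b : ℂ) / (ℏ : ℂ)))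
        - (Complex.I * (ℏ : ℂ)
          * ((hq : ℂ) * (w * ((ap : ℂ) / (2 * (d : ℂ)) + Complex.I * (bp : ℂ) / (ℏ : ℂ)))
            - (hp : ℂ) * (w * ((aq : ℂ) / (2 * (d : ℂ)) + Complex.I * (bq : ℂ) / (ℏ : ℂ))))
        - (L : ℂ) * w)
      = w * (((hq * bp - hp * bq + L - b : ℝ) : ℂ)
        + ((ℏ / (2 * d) * (a - (hq * ap - hp * aq)) : ℝ) : ℂ) * Complex.I) := by
    push_cast
    field_simp
    ring_nf
    simp only [Complex.I_sq]
    ring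
  have hc : ℏ / (2 * d) ≠ 0 := by positivity
  rw [← sub_eq_zero, key, mul_eq_zero, or_iff_right hw, Complex.ext_iff]
  simp only [Complex.add_re, Complex.add_im, Complex.re_ofReal_mul, Complex.im_ofReal_mul,
    Complex.ofReal_re, Complex.ofReal_im, Complex.I_re, Complex.I_im, Complex.zero_re,
    Complex.zero_im, mul_zero, mul_one, add_zero, zero_add]
  rw [mul_eq_zero, or_iff_right hc, sub_eq_zero, sub_eq_zero, and_comm]
  exact and_congr_right fun _ => eq_comm

/-- With `χ = √D e^{iS/ℏ}` (`D > 0`), the Koopman–van Hove equation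
holds iff `∂ₜD = {H, D}` and `∂ₜS = {H, S} + p ∂_p H − H`. -/
theorem kvh_polar_iff (ℏ : ℝ) (hℏ : 0 < ℏ)
    (H : ℝ × ℝ → ℝ) (hH : ContDiff ℝ (⊤ : ℕ∞) H)
    (D : ℝ → ℝ × ℝ → ℝ)
    (hD : ContDiff ℝ (⊤ : ℕ∞) (fun tz : ℝ × (ℝ × ℝ) => D tz.1 tz.2))
    (hDpos : ∀ t z, 0 < D t z)
    (S : ℝ → ℝ × ℝ → ℝ)
    (hS : ContDiff ℝ (⊤ : ℕ∞) (fun tz : ℝ × (ℝ × ℝ) => S tz.1 tz.2))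
    (χ : ℝ → ℝ × ℝ → ℂ)
    (hχ : ∀ t z, χ t z = (Real.sqrt (D t z) : ℂ) * Complex.exp (Complex.I * (S t z : ℂ) / (ℏ : ℂ))) :
    (∀ (t : ℝ) (z : ℝ × ℝ),
        Complex.I * (ℏ : ℂ) * deriv (fun s => χ s z) t
          = Complex.I * (ℏ : ℂ) * pb H (χ t) z - ((z.2 * dpR H z - H z : ℝ) : ℂ) * χ t z)
    ↔ ((∀ (t : ℝ) (z : ℝ × ℝ), deriv (fun s => D s z) t = pbR H (D t) z)
        ∧ (∀ (t : ℝ) (z : ℝ × ℝ),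
            deriv (fun s => S s z) t = pbR H (S t) z + z.2 * dpR H z - H z)) := by
  have hD' : Differentiable ℝ (fun tz : ℝ × (ℝ × ℝ) => D tz.1 tz.2) := hD.differentiable (by simp)
  have hS' : Differentiable ℝ (fun tz : ℝ × (ℝ × ℝ) => S tz.1 tz.2) := hS.differentiable (by simp)
  obtain rfl : χ = fun t z =>
      (Real.sqrt (D t z) : ℂ) * Complex.exp (Complex.I * (S t z : ℂ) / (ℏ : ℂ)) :=
    funext fun t => funext fun z => hχ t z
  rw [← forall_and]
  refine forall_congr' fun t => ?_
  rw [← forall_and]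
  refine forall_congr' fun z => ?_
  have along_curve (c : ℝ → ℝ × (ℝ × ℝ)) (hc : Differentiable ℝ c) (x : ℝ) :=
    deriv_sqrt_mul_cexp ℏ (hD'.comp hc x) (hS'.comp hc x) (hDpos (c x).1 (c x).2)
  have ht := along_curve (fun s => (s, z)) (by fun_prop) t
  have hq := along_curve (fun q => (t, (q, z.2))) (by fun_prop) z.1
  have hp := along_curve (fun p => (t, (z.1, p))) (by fun_prop) z.2
  simp only [Function.comp_def] at ht hq hp
  have hw : (Real.sqrt (D t z) : ℂ) * Complex.exp (Complex.I * (S t z : ℂ) / (ℏ : ℂ)) ≠ 0 :=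
    mul_ne_zero (by exact_mod_cast (Real.sqrt_pos.mpr (hDpos t z)).ne') (Complex.exp_ne_zero _)
  simp only [pb, pbR, dq, dp]
  rw [ht, hq, hp, add_sub_assoc]
  exact polar_equation_iff hℏ (hDpos t z) hw _ _ _ _ _ _ _ _ _
end

section
/- Let ℏ > 0, let H : ℝ² → ℝ be smooth, and let χ : ℝ × ℝ² → ℂ be smooth and satisfy the Koopman–van Hove equation iℏ ∂ₜχ = iℏ {H, χ} − (p ∂_p H − H) χ. Then the momentum-map density ρ_c(t,q,p) := |χ|² + ∂_p(p |χ|²) + ℏ Im {conj(χ), χ} (all brackets and derivatives taken in (q,p) at fixed t) satisfies the classical Liouville equation ∂ₜρ_c = {H, ρ_c}. -/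
open Complex MeasureTheory ComplexConjugate

/-- Algebraic form of the Liouville equation for the momentum-map density: `a` and `b` are the real
and imaginary parts of the wavefunction, and `c` and `k` are `ℏ` and `ℏ⁻¹`. -/
theorem liouville_of_commuting_derivations {A : Type*} [CommRing A] [Algebra ℝ A]
    (T Q P : Derivation ℝ A A) (hTQ : ∀ f, T (Q f) = Q (T f)) (hTP : ∀ f, T (P f) = P (T f))
    (hQP : ∀ f, Q (P f) = P (Q f)) (a b h p c k : A)
    (hQp : Q p = 0) (hPp : P p = 1) (hTp : T p = 0)
    (hTc : T c = 0) (hQc : Q c = 0) (hPc : P c = 0) (hQk : Q k = 0) (hPk : P k = 0)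
    (hkc : k * c = 1)
    (ha : T a = Q h * P a - P h * Q a - k * (p * P h - h) * b)
    (hb : T b = Q h * P b - P h * Q b + k * (p * P h - h) * a) :
    let ρ := 2 * (a * a + b * b) + 2 * (p * (a * P a + b * P b)) +
      2 * (c * (Q a * P b - P a * Q b))
    T ρ = Q h * P ρ - P h * Q ρ := by
  have h2 : ∀ D : Derivation ℝ A A, D 2 = 0 := fun D ↦ by exact_mod_cast D.map_natCast 2
  simp only [map_add, map_sub, Derivation.leibniz, smul_eq_mul, h2, hTQ, hTP, ha, hb,
    hQp, hPp, hTp, hTc, hQc, hPc, hQk, hPk, hQP]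
  linear_combination (2 * a * (Q h * P a - p * P a * P (Q h) + p * Q a * P (P h)) +
    2 * b * (Q h * P b - p * P b * P (Q h) + p * Q b * P (P h))) * hkc

/-- The algebra of smooth real-valued functions on a normed space. -/
def smoothFunctions (E : Type*) [NormedAddCommGroup E] [NormedSpace ℝ E] :
    Subalgebra ℝ (E → ℝ) where
  carrier := {f | ContDiff ℝ (⊤ : ℕ∞) f}
  mul_mem' {f g} (hf : ContDiff ℝ (⊤ : ℕ∞) f) (hg : ContDiff ℝ (⊤ : ℕ∞) g) :=
    show ContDiff ℝ (⊤ : ℕ∞) (f * g) from hf.mul hg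
  add_mem' {f g} (hf : ContDiff ℝ (⊤ : ℕ∞) f) (hg : ContDiff ℝ (⊤ : ℕ∞) g) :=
    show ContDiff ℝ (⊤ : ℕ∞) (f + g) from hf.add hg
  algebraMap_mem' r := show ContDiff ℝ (⊤ : ℕ∞) (fun _ : E ↦ r) from contDiff_const

section directionalDerivation

variable {E : Type*} [NormedAddCommGroup E] [NormedSpace ℝ E]

theorem mem_smoothFunctions {f : E → ℝ} : f ∈ smoothFunctions E ↔ ContDiff ℝ (⊤ : ℕ∞) f :=
  Iff.rfl

theorem differentiable_of_smoothFunctions (f : smoothFunctions E) : Differentiable ℝ f.1 :=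
  (mem_smoothFunctions.1 f.2).differentiable (by simp)

/-- The derivative of smooth functions in a fixed direction. -/
noncomputable def directionalDerivation (v : E) :
    Derivation ℝ (smoothFunctions E) (smoothFunctions E) :=
  Derivation.mk'
    { toFun f := ⟨fun x ↦ fderiv ℝ f.1 x v,
        mem_smoothFunctions.2 <|
        ((mem_smoothFunctions.1 f.2).fderiv_right (m := (⊤ : ℕ∞)) (by simp)).clm_apply
          contDiff_const⟩
      map_add' f g := by
        ext x
        simp [fderiv_add (differentiable_of_smoothFunctions f x)
          (differentiable_of_smoothFunctions g x)]
      map_smul' r f := by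
        ext x
        simp [fderiv_const_smul (differentiable_of_smoothFunctions f x) r] }
    fun f g ↦ by
      ext x
      simp [fderiv_mul (differentiable_of_smoothFunctions f x)
        (differentiable_of_smoothFunctions g x)]

theorem directionalDerivation_comm (v w : E) (f : smoothFunctions E) :
    directionalDerivation v (directionalDerivation w f) =
      directionalDerivation w (directionalDerivation v f) := by
  ext x
  have hf : ContDiff ℝ (⊤ : ℕ∞) f.1 := f.2
  have hd : DifferentiableAt ℝ (fderiv ℝ f.1) x :=
    (ContDiff.fderiv_right (m := (⊤ : ℕ∞)) hf (by simp)).differentiable (by simp) x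
  have hs : IsSymmSndFDerivAt ℝ f.1 x :=
    (contDiff_infty.1 hf 2).contDiffAt.isSymmSndFDerivAt (by simp)
  have key (u u' : E) : (directionalDerivation u (directionalDerivation u' f)).1 x =
      fderiv ℝ (fderiv ℝ f.1) x u u' := by
    change fderiv ℝ (fun y ↦ fderiv ℝ f.1 y u') x u = _
    rw [fderiv_clm_apply hd (differentiableAt_const u')]
    simp
  exact (key v w).trans ((hs.eq v w).trans (key w v).symm)

/-- The derivative of a smooth function along a curve with velocity `v`. -/
theorem hasDerivAt_comp_directionalDerivation (f : smoothFunctions E) {γ : ℝ → E} {v : E} {s : ℝ}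
    (hγ : HasDerivAt γ v s) :
    HasDerivAt (fun r ↦ f.1 (γ r)) ((directionalDerivation v f).1 (γ s)) s :=
  (differentiable_of_smoothFunctions f (γ s)).hasFDerivAt.comp_hasDerivAt s hγ

end directionalDerivation

section lines

variable (f : smoothFunctions (ℝ × (ℝ × ℝ))) (t q p : ℝ)

theorem hasDerivAt_time : HasDerivAt (fun s ↦ f.1 (s, (q, p)))
    ((directionalDerivation ((1, 0, 0) : ℝ × (ℝ × ℝ)) f).1 (t, (q, p))) t :=
  hasDerivAt_comp_directionalDerivation f (γ := fun s ↦ (s, (q, p)))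
    ((hasDerivAt_id t).prodMk (hasDerivAt_const t (q, p)))

theorem hasDerivAt_position : HasDerivAt (fun s ↦ f.1 (t, (s, p)))
    ((directionalDerivation ((0, 1, 0) : ℝ × (ℝ × ℝ)) f).1 (t, (q, p))) q :=
  hasDerivAt_comp_directionalDerivation f (γ := fun s ↦ (t, (s, p)))
    ((hasDerivAt_const q t).prodMk ((hasDerivAt_id q).prodMk (hasDerivAt_const q p)))

theorem hasDerivAt_momentum : HasDerivAt (fun s ↦ f.1 (t, (q, s)))
    ((directionalDerivation ((0, 0, 1) : ℝ × (ℝ × ℝ)) f).1 (t, (q, p))) p :=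
  hasDerivAt_comp_directionalDerivation f (γ := fun s ↦ (t, (q, s)))
    ((hasDerivAt_const p t).prodMk ((hasDerivAt_const p q).prodMk (hasDerivAt_id p)))

end lines

/-- A complex-valued function whose real and imaginary parts are differentiable. -/
theorem hasDerivAt_of_re_im {u : ℝ → ℂ} {x y : ℝ → ℝ} {x' y' s : ℝ}
    (hx : HasDerivAt x x' s) (hy : HasDerivAt y y' s) (hu : ∀ r, u r = x r + y r * I) :
    HasDerivAt u (x' + y' * I) s := by
  rw [funext hu]
  exact hx.ofReal_comp.add (hy.ofReal_comp.mul_const I)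

/-- If `χ` satisfies the Koopman–van Hove equation, then the
momentum-map density `ρ_c = |χ|² + ∂_p(p|χ|²) + ℏ Im {conj χ, χ}` satisfies the
classical Liouville equation `∂ₜρ_c = {H, ρ_c}`. -/
theorem kvh_momentum_map_liouville (ℏ : ℝ) (hℏ : 0 < ℏ)
    (H : ℝ × ℝ → ℝ) (hH : ContDiff ℝ (⊤ : ℕ∞) H)
    (χ : ℝ → ℝ × ℝ → ℂ)
    (hχ : ContDiff ℝ (⊤ : ℕ∞) (fun tz : ℝ × (ℝ × ℝ) => χ tz.1 tz.2))
    (hKvH : ∀ (t : ℝ) (z : ℝ × ℝ),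
      Complex.I * (ℏ : ℂ) * deriv (fun s => χ s z) t
        = Complex.I * (ℏ : ℂ) * pb H (χ t) z - ((z.2 * dpR H z - H z : ℝ) : ℂ) * χ t z)
    (ρc : ℝ → ℝ × ℝ → ℝ)
    (hρc : ∀ t z, ρc t z = Complex.normSq (χ t z)
        + dpR (fun w => w.2 * Complex.normSq (χ t w)) z
        + ℏ * (pbC (fun w => conj (χ t w)) (χ t) z).im) :
    ∀ (t : ℝ) (z : ℝ × ℝ), deriv (fun s => ρc s z) t = pbR H (ρc t) z := by
  let T := directionalDerivation ((1, 0, 0) : ℝ × (ℝ × ℝ))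
  let Q := directionalDerivation ((0, 1, 0) : ℝ × (ℝ × ℝ))
  let P := directionalDerivation ((0, 0, 1) : ℝ × (ℝ × ℝ))
  let a : smoothFunctions (ℝ × (ℝ × ℝ)) :=
    ⟨fun x ↦ (χ x.1 x.2).re, reCLM.contDiff.comp hχ⟩
  let b : smoothFunctions (ℝ × (ℝ × ℝ)) :=
    ⟨fun x ↦ (χ x.1 x.2).im, imCLM.contDiff.comp hχ⟩
  let h : smoothFunctions (ℝ × (ℝ × ℝ)) := ⟨fun x ↦ H x.2, hH.comp contDiff_snd⟩
  let m : smoothFunctions (ℝ × (ℝ × ℝ)) :=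
    ⟨fun x ↦ x.2.2, mem_smoothFunctions.2 (contDiff_snd.comp contDiff_snd)⟩
  let c := algebraMap ℝ (smoothFunctions (ℝ × (ℝ × ℝ))) ℏ
  let k := algebraMap ℝ (smoothFunctions (ℝ × (ℝ × ℝ))) ℏ⁻¹
  have hχab (t : ℝ) (z : ℝ × ℝ) : χ t z = a.1 (t, z) + b.1 (t, z) * I := (re_add_im _).symm
  have hχT (t q p : ℝ) : deriv (fun s ↦ χ s (q, p)) t
      = (T a).1 (t, (q, p)) + (T b).1 (t, (q, p)) * I :=
    (hasDerivAt_of_re_im (hasDerivAt_time a t q p) (hasDerivAt_time b t q p)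
      fun _ ↦ hχab _ _).deriv
  have hχQ (t q p : ℝ) : dq (χ t) (q, p)
      = (Q a).1 (t, (q, p)) + (Q b).1 (t, (q, p)) * I :=
    (hasDerivAt_of_re_im (hasDerivAt_position a t q p) (hasDerivAt_position b t q p)
      fun _ ↦ hχab _ _).deriv
  have hχP (t q p : ℝ) : dp (χ t) (q, p)
      = (P a).1 (t, (q, p)) + (P b).1 (t, (q, p)) * I :=
    (hasDerivAt_of_re_im (hasDerivAt_momentum a t q p) (hasDerivAt_momentum b t q p)
      fun _ ↦ hχab _ _).deriv
  have hχQ' (t q p : ℝ) : dq (fun w ↦ conj (χ t w)) (q, p)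
      = conj (dq (χ t) (q, p)) := by
    exact deriv.star
  have hχP' (t q p : ℝ) : dp (fun w ↦ conj (χ t w)) (q, p)
      = conj (dp (χ t) (q, p)) := by
    exact deriv.star
  have hHQ (t q p : ℝ) : dqR H (q, p) = (Q h).1 (t, (q, p)) :=
    (hasDerivAt_position h t q p).deriv
  have hHP (t q p : ℝ) : dpR H (q, p) = (P h).1 (t, (q, p)) :=
    (hasDerivAt_momentum h t q p).deriv
  have hTm : T m = 0 := by
    ext ⟨t, q, p⟩
    exact (hasDerivAt_time m t q p).unique (hasDerivAt_const t p)
  have hQm : Q m = 0 := by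
    ext ⟨t, q, p⟩
    exact (hasDerivAt_position m t q p).unique (hasDerivAt_const q p)
  have hPm : P m = 1 := by
    ext ⟨t, q, p⟩
    exact (hasDerivAt_momentum m t q p).unique (hasDerivAt_id p)
  have hℏ' : (ℏ : ℝ) ≠ 0 := hℏ.ne'
  have hkc : k * c = 1 := by
    rw [← map_mul, inv_mul_cancel₀ hℏ', map_one]
  have hab (t q p : ℝ) :
      (T a).1 (t, (q, p)) = (Q h * P a - P h * Q a - k * (m * P h - h) * b).1 (t, (q, p)) ∧
      (T b).1 (t, (q, p)) = (Q h * P b - P h * Q b + k * (m * P h - h) * a).1 (t, (q, p)) := by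
    have e := hKvH t (q, p)
    rw [hχT, pb, hχQ, hχP, hHQ t, hHP t, hχab] at e
    have er := congrArg re e
    have ei := congrArg im e
    simp at er ei
    change _ = (Q h).1 (t, (q, p)) * (P a).1 (t, (q, p)) - (P h).1 (t, (q, p)) * (Q a).1 (t, (q, p))
        - ℏ⁻¹ * (p * (P h).1 (t, (q, p)) - H (q, p)) * b.1 (t, (q, p)) ∧
      _ = (Q h).1 (t, (q, p)) * (P b).1 (t, (q, p)) - (P h).1 (t, (q, p)) * (Q b).1 (t, (q, p))
        + ℏ⁻¹ * (p * (P h).1 (t, (q, p)) - H (q, p)) * a.1 (t, (q, p))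
    constructor
    · field_simp
      linear_combination ei
    · field_simp
      linear_combination -er
  let ρ := 2 * (a * a + b * b) + 2 * (m * (a * P a + b * P b)) +
    2 * (c * (Q a * P b - P a * Q b))
  have hmain : T ρ = Q h * P ρ - P h * Q ρ :=
    liouville_of_commuting_derivations T Q P (directionalDerivation_comm _ _)
      (directionalDerivation_comm _ _) (directionalDerivation_comm _ _) a b h m c k hQm hPm hTm
      (T.map_algebraMap ℏ) (Q.map_algebraMap ℏ) (P.map_algebraMap ℏ)
      (Q.map_algebraMap ℏ⁻¹) (P.map_algebraMap ℏ⁻¹) hkc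
      (by ext ⟨t, q, p⟩; exact (hab t q p).1) (by ext ⟨t, q, p⟩; exact (hab t q p).2)
  have hρ (t : ℝ) (z : ℝ × ℝ) : ρc t z = ρ.1 (t, z) := by
    obtain ⟨q, p⟩ := z
    have hn : dpR (fun w ↦ w.2 * normSq (χ t w)) (q, p) = (P (m * (a * a + b * b))).1 (t, (q, p)) :=
      (hasDerivAt_momentum (m * (a * a + b * b)) t q p).deriv
    have hP : P (m * (a * a + b * b)) =
        a * a + b * b + 2 * (m * (a * P a + b * P b)) := by
      simp only [map_add, Derivation.leibniz, smul_eq_mul, hPm]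
      ring
    rw [hρc, hn, hP, pbC, hχQ', hχP', hχQ, hχP, hχab]
    change _ = 2 * (a.1 (t, (q, p)) * a.1 (t, (q, p)) + b.1 (t, (q, p)) * b.1 (t, (q, p)))
      + 2 * (p * (a.1 (t, (q, p)) * (P a).1 (t, (q, p)) + b.1 (t, (q, p)) * (P b).1 (t, (q, p))))
      + 2 * (ℏ * ((Q a).1 (t, (q, p)) * (P b).1 (t, (q, p))
        - (P a).1 (t, (q, p)) * (Q b).1 (t, (q, p))))
    change _ + (a.1 (t, (q, p)) * a.1 (t, (q, p)) + b.1 (t, (q, p)) * b.1 (t, (q, p))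
      + 2 * (p * (a.1 (t, (q, p)) * (P a).1 (t, (q, p))
        + b.1 (t, (q, p)) * (P b).1 (t, (q, p))))) + _ = _
    simp [normSq_apply]
    ring
  rintro t ⟨q, p⟩
  simp only [funext fun t ↦ funext (hρ t)]
  have h1 : deriv (fun s ↦ ρ.1 (s, (q, p))) t = (T ρ).1 (t, (q, p)) :=
    (hasDerivAt_time ρ t q p).deriv
  have h2 : dqR (fun z ↦ ρ.1 (t, z)) (q, p) = (Q ρ).1 (t, (q, p)) :=
    (hasDerivAt_position ρ t q p).deriv
  have h3 : dpR (fun z ↦ ρ.1 (t, z)) (q, p) = (P ρ).1 (t, (q, p)) :=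
    (hasDerivAt_momentum ρ t q p).deriv
  rw [h1, pbR, h2, h3, hHQ t, hHP t, hmain]
  rfl
end

section
/- Let ℏ > 0, let H : ℝ² → ℝ be smooth, and let χ : ℝ² → ℂ be smooth with compact support. Define ρ_c := |χ|² + ∂_p(p |χ|²) + ℏ Im {conj(χ), χ}. Then the Koopman–van Hove Hamiltonian functional is collective, i.e. it equals the physical energy: Re ∫_{ℝ²} conj(χ(z)) · ( iℏ {H, χ}(z) − (p ∂_p H(z) − H(z)) χ(z) ) dz = ∫_{ℝ²} ρ_c(z) H(z) dz, where integrals are with respect to Lebesgue measure on ℝ². -/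
open Complex MeasureTheory ComplexConjugate

lemma dqR_eq_fderiv {f : ℝ × ℝ → ℝ} {z : ℝ × ℝ} (hf : DifferentiableAt ℝ f z) :
    dqR f z = fderiv ℝ f z (1, 0) :=
  (hf.hasFDerivAt.comp_hasDerivAt z.1
    ((hasDerivAt_id z.1).prodMk (hasDerivAt_const z.1 z.2))).deriv

lemma dpR_eq_fderiv {f : ℝ × ℝ → ℝ} {z : ℝ × ℝ} (hf : DifferentiableAt ℝ f z) :
    dpR f z = fderiv ℝ f z (0, 1) :=
  (hf.hasFDerivAt.comp_hasDerivAt z.2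
    ((hasDerivAt_const z.2 z.1).prodMk (hasDerivAt_id z.2))).deriv

lemma dq_eq_fderiv {f : ℝ × ℝ → ℂ} {z : ℝ × ℝ} (hf : DifferentiableAt ℝ f z) :
    dq f z = fderiv ℝ f z (1, 0) :=
  (hf.hasFDerivAt.comp_hasDerivAt z.1
    ((hasDerivAt_id z.1).prodMk (hasDerivAt_const z.1 z.2))).deriv

lemma dp_eq_fderiv {f : ℝ × ℝ → ℂ} {z : ℝ × ℝ} (hf : DifferentiableAt ℝ f z) :
    dp f z = fderiv ℝ f z (0, 1) :=
  (hf.hasFDerivAt.comp_hasDerivAt z.2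
    ((hasDerivAt_const z.2 z.1).prodMk (hasDerivAt_id z.2))).deriv

/-- A directional derivative of a compactly supported `C¹` function is integrable. -/
lemma integrable_fderiv_apply_of_hasCompactSupport {F : ℝ × ℝ → ℝ} (hF : ContDiff ℝ 1 F)
    (hFc : HasCompactSupport F) (w : ℝ × ℝ) : Integrable fun z => fderiv ℝ F z w :=
  ((hF.continuous_fderiv one_ne_zero).clm_apply continuous_const).integrable_of_hasCompactSupport
    (hFc.fderiv_apply ℝ w)

/-- A directional derivative of a compactly supported `C¹` function has vanishing integral. -/
lemma integral_fderiv_apply_eq_zero_of_hasCompactSupport {F : ℝ × ℝ → ℝ} (hF : ContDiff ℝ 1 F)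
    (hFc : HasCompactSupport F) (w : ℝ × ℝ) : ∫ z, fderiv ℝ F z w = 0 := by
  have h := integral_mul_fderiv_eq_neg_fderiv_mul_of_integrable (μ := volume) (v := w)
    (f := fun _ : ℝ × ℝ => (1 : ℝ)) (g := F) (by simp)
    (by simpa using integrable_fderiv_apply_of_hasCompactSupport hF hFc w)
    (by simpa using hF.continuous.integrable_of_hasCompactSupport hFc)
    (fun z _ => differentiableAt_const _) (fun z _ => hF.differentiable one_ne_zero z)
  simpa using h

lemma fderiv_re_apply {f : ℝ × ℝ → ℂ} {z : ℝ × ℝ} (hf : DifferentiableAt ℝ f z) (w : ℝ × ℝ) :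
    fderiv ℝ (fun x => (f x).re) z w = (fderiv ℝ f z w).re :=
  congrArg (· w) (reCLM.hasFDerivAt.comp z hf.hasFDerivAt).fderiv

lemma fderiv_im_apply {f : ℝ × ℝ → ℂ} {z : ℝ × ℝ} (hf : DifferentiableAt ℝ f z) (w : ℝ × ℝ) :
    fderiv ℝ (fun x => (f x).im) z w = (fderiv ℝ f z w).im :=
  congrArg (· w) (imCLM.hasFDerivAt.comp z hf.hasFDerivAt).fderiv

lemma fderiv_conj_apply {f : ℝ × ℝ → ℂ} {z : ℝ × ℝ} (hf : DifferentiableAt ℝ f z) (w : ℝ × ℝ) :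
    fderiv ℝ (fun x => conj (f x)) z w = conj (fderiv ℝ f z w) :=
  congrArg (· w) (conjCLE.toContinuousLinearMap.hasFDerivAt.comp z hf.hasFDerivAt).fderiv

/-- The current `u ∂_w v - v ∂_w u`, that is `Im (conj χ ∂_w χ)` for `χ = u + i v`. -/
noncomputable def current (u v : ℝ × ℝ → ℝ) (w z : ℝ × ℝ) : ℝ :=
  u z * fderiv ℝ v z w - v z * fderiv ℝ u z w

lemma contDiff_fderiv_apply {u : ℝ × ℝ → ℝ} (hu : ContDiff ℝ 2 u) (w : ℝ × ℝ) :
    ContDiff ℝ 1 fun z => fderiv ℝ u z w :=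
  (hu.fderiv_right (m := 1) (by norm_num)).clm_apply contDiff_const

lemma contDiff_current {u v : ℝ × ℝ → ℝ} (hu : ContDiff ℝ 2 u) (hv : ContDiff ℝ 2 v)
    (w : ℝ × ℝ) : ContDiff ℝ 1 (current u v w) :=
  ((hu.of_le one_le_two).mul (contDiff_fderiv_apply hv w)).sub
    ((hv.of_le one_le_two).mul (contDiff_fderiv_apply hu w))

lemma fderiv_fderiv_apply {u : ℝ × ℝ → ℝ} (hu : ContDiff ℝ 2 u) (z w w' : ℝ × ℝ) :
    fderiv ℝ (fun x => fderiv ℝ u x w) z w' = fderiv ℝ (fderiv ℝ u) z w' w := by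
  have h : DifferentiableAt ℝ (fderiv ℝ u) z :=
    (hu.fderiv_right (m := 1) (by norm_num)).differentiable one_ne_zero z
  rw [fderiv_clm_apply h (differentiableAt_const w)]
  simp

lemma fderiv_current_apply {u v : ℝ × ℝ → ℝ} (hu : ContDiff ℝ 2 u) (hv : ContDiff ℝ 2 v)
    (z w w' : ℝ × ℝ) :
    fderiv ℝ (current u v w) z w' =
      fderiv ℝ u z w' * fderiv ℝ v z w + u z * fderiv ℝ (fderiv ℝ v) z w' w
        - (fderiv ℝ v z w' * fderiv ℝ u z w + v z * fderiv ℝ (fderiv ℝ u) z w' w) := by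
  have du := hu.differentiable two_ne_zero z
  have dv := hv.differentiable two_ne_zero z
  have du' := (contDiff_fderiv_apply hu w).differentiable one_ne_zero z
  have dv' := (contDiff_fderiv_apply hv w).differentiable one_ne_zero z
  unfold current
  rw [fderiv_fun_sub (du.fun_mul dv') (dv.fun_mul du'), fderiv_fun_mul du dv', fderiv_fun_mul dv du']
  simp only [sub_apply, add_apply, smul_apply, smul_eq_mul, fderiv_fderiv_apply hu,
    fderiv_fderiv_apply hv]
  ring

/-- The curl of the current is twice the Poisson bracket of `u` and `v`. -/
lemma fderiv_current_sub_fderiv_current {u v : ℝ × ℝ → ℝ} (hu : ContDiff ℝ 2 u)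
    (hv : ContDiff ℝ 2 v) (z w w' : ℝ × ℝ) :
    fderiv ℝ (current u v w) z w' - fderiv ℝ (current u v w') z w =
      2 * (fderiv ℝ u z w' * fderiv ℝ v z w - fderiv ℝ u z w * fderiv ℝ v z w') := by
  have su : fderiv ℝ (fderiv ℝ u) z w' w = fderiv ℝ (fderiv ℝ u) z w w' :=
    hu.contDiffAt.isSymmSndFDerivAt (by simp) w' w
  have sv : fderiv ℝ (fderiv ℝ v) z w' w = fderiv ℝ (fderiv ℝ v) z w w' :=
    hv.contDiffAt.isSymmSndFDerivAt (by simp) w' w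
  rw [fderiv_current_apply hu hv, fderiv_current_apply hu hv, su, sv]
  ring

/-- The Koopman–van Hove Hamiltonian functional is collective:
`Re ∫ conj(χ) (iℏ{H,χ} − (p∂_pH − H)χ) dz = ∫ ρ_c H dz` where
`ρ_c = |χ|² + ∂_p(p|χ|²) + ℏ Im {conj χ, χ}`. -/
theorem kvh_hamiltonian_collective (ℏ : ℝ) (hℏ : 0 < ℏ)
    (H : ℝ × ℝ → ℝ) (hH : ContDiff ℝ (⊤ : ℕ∞) H)
    (χ : ℝ × ℝ → ℂ) (hχ : ContDiff ℝ (⊤ : ℕ∞) χ) (hχc : HasCompactSupport χ)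
    (ρc : ℝ × ℝ → ℝ)
    (hρc : ∀ z, ρc z = Complex.normSq (χ z)
        + dpR (fun w => w.2 * Complex.normSq (χ w)) z
        + ℏ * (pbC (fun w => conj (χ w)) χ z).im) :
    (∫ z : ℝ × ℝ,
        conj (χ z) * (Complex.I * (ℏ : ℂ) * pb H χ z
          - ((z.2 * dpR H z - H z : ℝ) : ℂ) * χ z)).re
      = ∫ z : ℝ × ℝ, ρc z * H z := by
  have hH2 : ContDiff ℝ 2 H := hH.of_le (by norm_cast)
  have hχ2 : ContDiff ℝ 2 χ := hχ.of_le (by norm_cast)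
  have hH1 : ContDiff ℝ 1 H := hH2.of_le one_le_two
  have dH := hH1.differentiable one_ne_zero
  have dχ := hχ2.differentiable two_ne_zero
  set u : ℝ × ℝ → ℝ := fun z => (χ z).re with hu_def
  set v : ℝ × ℝ → ℝ := fun z => (χ z).im with hv_def
  have hu : ContDiff ℝ 2 u := reCLM.contDiff.comp hχ2
  have hv : ContDiff ℝ 2 v := imCLM.contDiff.comp hχ2
  have huc : HasCompactSupport u := hχc.comp_left (g := Complex.re) rfl
  have hvc : HasCompactSupport v := hχc.comp_left (g := Complex.im) rfl
  have hJ (w : ℝ × ℝ) : ContDiff ℝ 1 (current u v w) := contDiff_current hu hv w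
  have hJc (w : ℝ × ℝ) : HasCompactSupport (current u v w) :=
    (huc.mul_right (f' := fun z => fderiv ℝ v z w)).sub
      (hvc.mul_right (f' := fun z => fderiv ℝ u z w))
  set N : ℝ × ℝ → ℝ := fun z => z.2 * normSq (χ z) with hN_def
  have hN : ContDiff ℝ 1 N := by
    have : N = fun z => z.2 * (u z * u z + v z * v z) := rfl
    rw [this]
    exact contDiff_snd.mul (((hu.mul hu).add (hv.mul hv)).of_le one_le_two)
  have hNc : HasCompactSupport N :=
    (hχc.comp_left (g := normSq) (map_zero _)).mul_left (f := Prod.snd)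
  set F₁ : ℝ × ℝ → ℝ := fun z => H z * (-ℏ * current u v (0, 1) z) with hF₁_def
  set F₂ : ℝ × ℝ → ℝ := fun z => H z * (ℏ * current u v (1, 0) z - N z) with hF₂_def
  have hG₁ : ContDiff ℝ 1 fun z => -ℏ * current u v (0, 1) z := contDiff_const.mul (hJ _)
  have hG₂ : ContDiff ℝ 1 fun z => ℏ * current u v (1, 0) z - N z :=
    (contDiff_const.mul (hJ _)).sub hN
  have hF₁ : ContDiff ℝ 1 F₁ := hH1.mul hG₁
  have hF₂ : ContDiff ℝ 1 F₂ := hH1.mul hG₂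
  have hF₁c : HasCompactSupport F₁ :=
    ((hJc _).mul_left (f := fun _ => -ℏ)).mul_left (f := H)
  have hF₂c : HasCompactSupport F₂ :=
    (((hJc _).mul_left (f := fun _ => ℏ)).sub hNc).mul_left (f := H)
  set f : ℝ × ℝ → ℂ := fun z => conj (χ z) * (Complex.I * (ℏ : ℂ) * pb H χ z
    - ((z.2 * dpR H z - H z : ℝ) : ℂ) * χ z) with hf_def
  have hfi : Integrable f := by
    have cH (w : ℝ × ℝ) : Continuous fun z => fderiv ℝ H z w :=
      (hH1.continuous_fderiv one_ne_zero).clm_apply continuous_const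
    have cχ (w : ℝ × ℝ) : Continuous fun z => fderiv ℝ χ z w :=
      (hχ2.continuous_fderiv two_ne_zero).clm_apply continuous_const
    have cχ₀ := hχ.continuous
    have cH₀ := hH.continuous
    refine Continuous.integrable_of_hasCompactSupport ?_
      ((hχc.comp_left (g := conj) (map_zero _)).mul_right)
    simp only [hf_def, pb, dqR_eq_fderiv (dH _), dpR_eq_fderiv (dH _), dq_eq_fderiv (dχ _),
      dp_eq_fderiv (dχ _)]
    have cHq := cH (1, 0)
    have cHp := cH (0, 1)
    have cχq := cχ (1, 0)
    have cχp := cχ (0, 1)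
    fun_prop
  have key (z : ℝ × ℝ) :
      ρc z * H z = (f z).re - (fderiv ℝ F₁ z (1, 0) + fderiv ℝ F₂ z (0, 1)) := by
    have dconj : DifferentiableAt ℝ (fun w => conj (χ w)) z :=
      (conjCLE.toContinuousLinearMap.contDiff.comp hχ2).differentiable two_ne_zero z
    have dJ (w : ℝ × ℝ) := (hJ w).differentiable one_ne_zero z
    have dN := hN.differentiable one_ne_zero z
    have h₁ : fderiv ℝ F₁ z (1, 0) = fderiv ℝ H z (1, 0) * (-ℏ * current u v (0, 1) z)
        + H z * (-ℏ * fderiv ℝ (current u v (0, 1)) z (1, 0)) := by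
      rw [hF₁_def, fderiv_fun_mul (dH z) (hG₁.differentiable one_ne_zero z),
        fderiv_const_mul (dJ _)]
      simp only [add_apply, smul_apply, smul_eq_mul]
      ring
    have h₂ : fderiv ℝ F₂ z (0, 1) = fderiv ℝ H z (0, 1) * (ℏ * current u v (1, 0) z - N z)
        + H z * (ℏ * fderiv ℝ (current u v (1, 0)) z (0, 1) - fderiv ℝ N z (0, 1)) := by
      rw [hF₂_def, fderiv_fun_mul (dH z) (hG₂.differentiable one_ne_zero z),
        fderiv_fun_sub ((dJ _).const_mul ℏ) dN, fderiv_const_mul (dJ _)]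
      simp only [add_apply, sub_apply, smul_apply, smul_eq_mul]
      ring
    have curl := fderiv_current_sub_fderiv_current hu hv z (0, 1) (1, 0)
    rw [hρc, h₁, h₂]
    simp only [hf_def, pb, pbC, dqR_eq_fderiv (dH z), dpR_eq_fderiv (dH z),
      dq_eq_fderiv (dχ z), dp_eq_fderiv (dχ z), dq_eq_fderiv dconj, dp_eq_fderiv dconj,
      dpR_eq_fderiv dN, fderiv_conj_apply (dχ z)]
    simp only [current, hu_def, hv_def, fderiv_re_apply (dχ z), fderiv_im_apply (dχ z), hN_def]
      at curl ⊢
    simp only [mul_re, mul_im, sub_re, sub_im, conj_re, conj_im, I_re, I_im, ofReal_re, ofReal_im,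
      normSq_apply]
    linear_combination (-ℏ * H z) * curl
  have hF₁i := integrable_fderiv_apply_of_hasCompactSupport hF₁ hF₁c (1, 0)
  have hF₂i := integrable_fderiv_apply_of_hasCompactSupport hF₂ hF₂c (0, 1)
  calc (∫ z, f z).re = ∫ z, (f z).re := (integral_re hfi).symm
    _ = ∫ z, ((f z).re - (fderiv ℝ F₁ z (1, 0) + fderiv ℝ F₂ z (0, 1))) := by
      have hfre : Integrable fun z => (f z).re := hfi.re
      rw [integral_sub hfre (hF₁i.fun_add hF₂i), integral_add hF₁i hF₂i,
        integral_fderiv_apply_eq_zero_of_hasCompactSupport hF₁ hF₁c,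
        integral_fderiv_apply_eq_zero_of_hasCompactSupport hF₂ hF₂c]
      simp
    _ = ∫ z, ρc z * H z := by simp only [key]
end

section
/- Let ℏ > 0, let H : ℝ² → ℝ be smooth, and let χ : ℝ × ℝ² → ℂ be smooth, satisfy the Koopman–van Hove equation iℏ ∂ₜχ = iℏ {H, χ} − (p ∂_p H − H) χ, and suppose there is a compact set K ⊆ ℝ² such that χ(t,z) = 0 for all t and all z ∉ K. Then the L² norm is conserved: the function t ↦ ∫_{ℝ²} |χ(t,z)|² dz is constant. -/
open Complex MeasureTheory ComplexConjugate

/-- The Poisson bracket of a `C²` function with a compactly supported `C¹` function, formed with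
respect to two directions `u` and `v`, has vanishing integral. -/
theorem integral_fderiv_mul_sub_fderiv_mul_eq_zero {E : Type*} [NormedAddCommGroup E]
    [NormedSpace ℝ E] [FiniteDimensional ℝ E] [MeasurableSpace E] [BorelSpace E]
    (μ : Measure E) [μ.IsAddHaarMeasure] {f g : E → ℝ} (hf : ContDiff ℝ 2 f)
    (hg : ContDiff ℝ 1 g) (hgc : HasCompactSupport g) (u v : E) :
    ∫ x, (fderiv ℝ f x u * fderiv ℝ g x v - fderiv ℝ f x v * fderiv ℝ g x u) ∂μ = 0 := by
  have hf' : ContDiff ℝ 1 (fderiv ℝ f) := hf.fderiv_right (by norm_num)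
  have hf'_apply (w : E) : ContDiff ℝ 1 fun x => fderiv ℝ f x w := hf'.clm_apply contDiff_const
  have hg'_apply (w : E) : Continuous fun x => fderiv ℝ g x w :=
    (hg.continuous_fderiv one_ne_zero).clm_apply continuous_const
  have hint (a b : E) : Integrable (fun x => fderiv ℝ f x a * fderiv ℝ g x b) μ :=
    ((hf'_apply a).continuous.mul (hg'_apply b)).integrable_of_hasCompactSupport
      (hgc.fderiv_apply ℝ b).mul_left
  have hparts (a b : E) : ∫ x, fderiv ℝ f x a * fderiv ℝ g x b ∂μ
      = -∫ x, fderiv ℝ (fderiv ℝ f) x b a * g x ∂μ := by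
    rw [integral_mul_fderiv_eq_neg_fderiv_mul_of_integrable (f := fun x => fderiv ℝ f x a)
      ((((hf'_apply a).continuous_fderiv one_ne_zero).clm_apply
        continuous_const).mul hg.continuous |>.integrable_of_hasCompactSupport hgc.mul_left)
      (hint a b)
      (((hf'_apply a).continuous.mul hg.continuous).integrable_of_hasCompactSupport hgc.mul_left)
      (fun x _ => (hf'_apply a).differentiable one_ne_zero x)
      (fun x _ => hg.differentiable one_ne_zero x)]
    congr 2 with x
    rw [fderiv_clm_apply (hf'.differentiable one_ne_zero x) (differentiableAt_const a)]
    simp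
  rw [integral_sub (hint u v) (hint v u), hparts, hparts, sub_eq_zero]
  congr 2 with x
  rw [(hf.contDiffAt.isSymmSndFDerivAt (by simp)) v u]

/-- Differentiation under the integral sign for a jointly `C¹` family of functions supported in a
common compact set. -/
theorem hasDerivAt_integral_of_contDiff_of_forall_notMem_eq_zero {E : Type*}
    [NormedAddCommGroup E] [NormedSpace ℝ E] [MeasurableSpace E] [BorelSpace E]
    (μ : Measure E) [IsFiniteMeasureOnCompacts μ] {F : ℝ → E → ℝ}
    (hF : ContDiff ℝ 1 fun tx : ℝ × E => F tx.1 tx.2) {K : Set E} (hK : IsCompact K)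
    (hFK : ∀ t, ∀ x ∉ K, F t x = 0) (t : ℝ) :
    HasDerivAt (fun s => ∫ x, F s x ∂μ) (∫ x, deriv (fun s => F s x) t ∂μ) t := by
  set F' : ℝ → E → ℝ := fun s x => fderiv ℝ (fun tx : ℝ × E => F tx.1 tx.2) (s, x) (1, 0)
  have hF'_cont : Continuous fun tx : ℝ × E => F' tx.1 tx.2 :=
    (hF.continuous_fderiv one_ne_zero).clm_apply continuous_const
  have hderiv (s : ℝ) (x : E) : HasDerivAt (fun r => F r x) (F' s x) s :=
    HasFDerivAt.comp_hasDerivAt (f := fun r : ℝ => (r, x)) s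
      (hF.differentiable one_ne_zero (s, x)).hasFDerivAt
      ((hasDerivAt_id s).prodMk (hasDerivAt_const s x))
  have hF'K (s : ℝ) (x : E) (hx : x ∉ K) : F' s x = 0 := by
    rw [← (hderiv s x).deriv]
    simp [hFK _ x hx]
  have hcs {f : E → ℝ} (hf : Continuous f) (hf0 : ∀ x ∉ K, f x = 0) : Integrable f μ :=
    hf.integrable_of_hasCompactSupport (HasCompactSupport.intro hK hf0)
  have hFint (s : ℝ) : Integrable (F s) μ :=
    hcs (hF.continuous.comp (Continuous.prodMk_right s)) (hFK s)
  obtain ⟨C, hC⟩ := ((isCompact_Icc (a := t - 1) (b := t + 1)).prod hK).exists_bound_of_continuousOn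
    hF'_cont.continuousOn
  have hdom := hasDerivAt_integral_of_dominated_loc_of_deriv_le (μ := μ) (F := F) (F' := F')
    (s := Set.Icc (t - 1) (t + 1)) (x₀ := t) (bound := K.indicator fun _ => C)
    (Icc_mem_nhds (by linarith) (by linarith))
    (.of_forall fun s => (hFint s).aestronglyMeasurable) (hFint t)
    (hcs (hF'_cont.comp (Continuous.prodMk_right t)) (hF'K t)).aestronglyMeasurable
    (.of_forall fun x s hs => by
      by_cases hx : x ∈ K
      · simpa [hx] using hC (s, x) ⟨hs, hx⟩
      · simp [hx, hF'K s x hx])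
    ((integrable_indicator_iff hK.measurableSet).2 (integrableOn_const hK.measure_lt_top.ne))
    (.of_forall fun x s _ => hderiv s x)
  simpa only [(hderiv t _).deriv] using hdom.2

theorem HasDerivAt.complex_normSq {f : ℝ → ℂ} {f' : ℂ} {t : ℝ} (hf : HasDerivAt f f' t) :
    HasDerivAt (fun s => normSq (f s)) (2 * ((f t).re * f'.re + (f t).im * f'.im)) t := by
  simp only [normSq_eq_norm_sq]
  convert hf.norm_sq using 1
  simp [Complex.inner, mul_comm]

theorem DifferentiableAt.hasDerivAt_fst {F : Type*} [NormedAddCommGroup F] [NormedSpace ℝ F]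
    {f : ℝ × ℝ → F} {z : ℝ × ℝ} (hf : DifferentiableAt ℝ f z) :
    HasDerivAt (fun q => f (q, z.2)) (fderiv ℝ f z (1, 0)) z.1 :=
  hf.hasFDerivAt.comp_hasDerivAt z.1 ((hasDerivAt_id z.1).prodMk (hasDerivAt_const z.1 z.2))

theorem DifferentiableAt.hasDerivAt_snd {F : Type*} [NormedAddCommGroup F] [NormedSpace ℝ F]
    {f : ℝ × ℝ → F} {z : ℝ × ℝ} (hf : DifferentiableAt ℝ f z) :
    HasDerivAt (fun p => f (z.1, p)) (fderiv ℝ f z (0, 1)) z.2 :=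
  hf.hasFDerivAt.comp_hasDerivAt z.2 ((hasDerivAt_const z.2 z.1).prodMk (hasDerivAt_id z.2))

theorem contDiff_complex_normSq {n : WithTop ℕ∞} : ContDiff ℝ n (normSq : ℂ → ℝ) := by
  simpa only [← normSq_eq_norm_sq] using contDiff_norm_sq (n := n) ℝ (E := ℂ)

/-- The bracket of a real function with `|f|²`. -/
theorem fderiv_mul_sub_fderiv_mul_normSq_eq_pb {H : ℝ × ℝ → ℝ} {f : ℝ × ℝ → ℂ} {z : ℝ × ℝ}
    (hH : DifferentiableAt ℝ H z) (hf : DifferentiableAt ℝ f z) :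
    fderiv ℝ H z (1, 0) * fderiv ℝ (fun w => normSq (f w)) z (0, 1)
        - fderiv ℝ H z (0, 1) * fderiv ℝ (fun w => normSq (f w)) z (1, 0)
      = 2 * ((f z).re * (pb H f z).re + (f z).im * (pb H f z).im) := by
  have hN : DifferentiableAt ℝ (fun w => normSq (f w)) z :=
    (contDiff_complex_normSq.differentiable one_ne_zero (f z)).comp z hf
  rw [hN.hasDerivAt_snd.unique hf.hasDerivAt_snd.complex_normSq,
    hN.hasDerivAt_fst.unique hf.hasDerivAt_fst.complex_normSq]
  simp only [pb, dqR, dpR, dq, dp, hH.hasDerivAt_snd.deriv,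
    hH.hasDerivAt_fst.deriv, hf.hasDerivAt_snd.deriv,
    hf.hasDerivAt_fst.deriv, sub_re, sub_im, re_ofReal_mul, im_ofReal_mul]
  ring

/-- The `L²` norm of a compactly supported smooth solution of the
Koopman–van Hove equation is conserved in time. -/
theorem kvh_norm_conservation (ℏ : ℝ) (hℏ : 0 < ℏ)
    (H : ℝ × ℝ → ℝ) (hH : ContDiff ℝ (⊤ : ℕ∞) H)
    (χ : ℝ → ℝ × ℝ → ℂ)
    (hχ : ContDiff ℝ (⊤ : ℕ∞) (fun tz : ℝ × (ℝ × ℝ) => χ tz.1 tz.2))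
    (hKvH : ∀ (t : ℝ) (z : ℝ × ℝ),
      Complex.I * (ℏ : ℂ) * deriv (fun s => χ s z) t
        = Complex.I * (ℏ : ℂ) * pb H (χ t) z - ((z.2 * dpR H z - H z : ℝ) : ℂ) * χ t z)
    (K : Set (ℝ × ℝ)) (hK : IsCompact K)
    (hsupp : ∀ (t : ℝ) (z : ℝ × ℝ), z ∉ K → χ t z = 0) :
    ∀ t₁ t₂ : ℝ,
      ∫ z : ℝ × ℝ, Complex.normSq (χ t₁ z) = ∫ z : ℝ × ℝ, Complex.normSq (χ t₂ z) := by
  have hχ_time (t : ℝ) (z : ℝ × ℝ) : DifferentiableAt ℝ (fun s => χ s z) t :=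
    (hχ.comp (contDiff_id.prodMk contDiff_const)).differentiable (by simp) t
  have hχ_space (t : ℝ) : ContDiff ℝ (⊤ : ℕ∞) (χ t) := hχ.comp (contDiff_const.prodMk contDiff_id)
  have hN_zero (t : ℝ) (z : ℝ × ℝ) (hz : z ∉ K) : normSq (χ t z) = 0 := by simp [hsupp t z hz]
  have hN_time (t : ℝ) (z : ℝ × ℝ) : deriv (fun s => normSq (χ s z)) t
      = fderiv ℝ H z (1, 0) * fderiv ℝ (fun w => normSq (χ t w)) z (0, 1)
        - fderiv ℝ H z (0, 1) * fderiv ℝ (fun w => normSq (χ t w)) z (1, 0) := by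
    rw [fderiv_mul_sub_fderiv_mul_normSq_eq_pb (hH.differentiable (by simp) z)
      ((hχ_space t).differentiable (by simp) z), (hχ_time t z).hasDerivAt.complex_normSq.deriv]
    have hre := congrArg Complex.re (hKvH t z)
    have him := congrArg Complex.im (hKvH t z)
    simp only [sub_re, sub_im, re_ofReal_mul, im_ofReal_mul, mul_assoc, I_mul_re, I_mul_im]
      at hre him
    refine mul_left_cancel₀ hℏ.ne' ?_
    linear_combination 2 * (χ t z).re * him - 2 * (χ t z).im * hre
  have hderiv (t : ℝ) : HasDerivAt (fun s => ∫ z, normSq (χ s z)) 0 t := by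
    have h := hasDerivAt_integral_of_contDiff_of_forall_notMem_eq_zero volume
      (F := fun s z => normSq (χ s z))
      (contDiff_complex_normSq.comp (hχ.of_le (by simp))) hK hN_zero t
    simp only [hN_time] at h
    rwa [integral_fderiv_mul_sub_fderiv_mul_eq_zero volume (contDiff_infty.1 hH 2)
      (g := fun z => normSq (χ t z))
      (contDiff_complex_normSq.comp ((hχ_space t).of_le (by simp)))
      (HasCompactSupport.intro hK (hN_zero t))] at h
  exact is_const_of_deriv_eq_zero (fun t => (hderiv t).differentiableAt) fun t => (hderiv t).deriv
end

section
/- Let ℏ > 0, let n ∈ ℕ, let Ĥ : ℝ² → Matrix (Fin n) (Fin n) ℂ be smooth with Ĥ(z) Hermitian for every z ∈ ℝ², and let Υ₁, Υ₂ : ℝ² → ℂⁿ be smooth with compact support. Define the hybrid Liouvillian (L Υ)(z) := iℏ ( ∂_q Ĥ(z) · ∂_p Υ(z) − ∂_p Ĥ(z) · ∂_q Υ(z) ) − ( p ∂_p Ĥ(z) − Ĥ(z) ) · Υ(z), where matrices act on the ℂⁿ-valued functions pointwise. Then L is symmetric with respect to the L²(ℝ², ℂⁿ) inner product: ∫_{ℝ²}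 ⟨(L Υ₁)(z), Υ₂(z)⟩ dz = ∫_{ℝ²} ⟨Υ₁(z), (L Υ₂)(z)⟩ dz; i.e. the right-hand side of the quantum–classical wave equation iℏ ∂ₜΥ = {iℏ Ĥ, Υ} − (p ∂_p Ĥ − Ĥ) Υ is generated by a Hermitian operator on the hybrid Hilbert space. -/
open Complex MeasureTheory ComplexConjugate Matrix

/-- Partial derivative in `q` of a matrix-valued phase-space function (entrywise). -/
noncomputable def dqM {n : ℕ} (A : ℝ × ℝ → Matrix (Fin n) (Fin n) ℂ) (z : ℝ × ℝ) :
    Matrix (Fin n) (Fin n) ℂ :=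
  fun i j => deriv (fun q : ℝ => A (q, z.2) i j) z.1

/-- Partial derivative in `p` of a matrix-valued phase-space function (entrywise). -/
noncomputable def dpM {n : ℕ} (A : ℝ × ℝ → Matrix (Fin n) (Fin n) ℂ) (z : ℝ × ℝ) :
    Matrix (Fin n) (Fin n) ℂ :=
  fun i j => deriv (fun p : ℝ => A (z.1, p) i j) z.2

/-- Partial derivative in `q` of a vector-valued phase-space function (componentwise). -/
noncomputable def dqV {n : ℕ} (f : ℝ × ℝ → Fin n → ℂ) (z : ℝ × ℝ) : Fin n → ℂ :=
  fun i => deriv (fun q : ℝ => f (q, z.2) i) z.1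

/-- Partial derivative in `p` of a vector-valued phase-space function (componentwise). -/
noncomputable def dpV {n : ℕ} (f : ℝ × ℝ → Fin n → ℂ) (z : ℝ × ℝ) : Fin n → ℂ :=
  fun i => deriv (fun p : ℝ => f (z.1, p) i) z.2

/-- The hybrid Liouvillian
`(L Υ)(z) = iℏ (∂_q Ĥ · ∂_p Υ − ∂_p Ĥ · ∂_q Υ) − (p ∂_p Ĥ − Ĥ) · Υ(z)`. -/
noncomputable def hybridLiouvillian {n : ℕ} (ℏ : ℝ)
    (A : ℝ × ℝ → Matrix (Fin n) (Fin n) ℂ) (Υ : ℝ × ℝ → Fin n → ℂ) (z : ℝ × ℝ) :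
    Fin n → ℂ :=
  fun i => Complex.I * (ℏ : ℂ) *
      ((dqM A z).mulVec (dpV Υ z) i - (dpM A z).mulVec (dqV Υ z) i)
    - ((z.2 : ℂ) • dpM A z - A z).mulVec (Υ z) i

theorem deriv_slice_fst {f : ℝ × ℝ → ℂ} {z : ℝ × ℝ} (hf : DifferentiableAt ℝ f z) :
    deriv (fun q : ℝ => f (q, z.2)) z.1 = fderiv ℝ f z (1, 0) :=
  (hf.hasFDerivAt.comp_hasDerivAt z.1
    ((hasDerivAt_id z.1).prodMk (hasDerivAt_const z.1 z.2))).deriv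

theorem deriv_slice_snd {f : ℝ × ℝ → ℂ} {z : ℝ × ℝ} (hf : DifferentiableAt ℝ f z) :
    deriv (fun p : ℝ => f (z.1, p)) z.2 = fderiv ℝ f z (0, 1) :=
  (hf.hasFDerivAt.comp_hasDerivAt z.2
    ((hasDerivAt_const z.2 z.1).prodMk (hasDerivAt_id z.2))).deriv

theorem ContDiff.continuous_fderiv_const_apply {f : ℝ × ℝ → ℂ} (hf : ContDiff ℝ 1 f)
    (v : ℝ × ℝ) : Continuous fun z => fderiv ℝ f z v :=
  (hf.continuous_fderiv one_ne_zero).clm_apply continuous_const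

theorem integrable_fderiv_mul_fderiv {f g : ℝ × ℝ → ℂ} (hf : ContDiff ℝ 1 f)
    (hg : ContDiff ℝ 1 g) (hc : HasCompactSupport g) (v w : ℝ × ℝ) :
    Integrable fun z => fderiv ℝ f z v * fderiv ℝ g z w :=
  ((hf.continuous_fderiv_const_apply v).mul
    (hg.continuous_fderiv_const_apply w)).integrable_of_hasCompactSupport
    (hc.fderiv_apply (𝕜 := ℝ) w).mul_left

theorem integral_fderiv_mul_fderiv_comm {f g : ℝ × ℝ → ℂ} (hf : ContDiff ℝ 2 f)
    (hg : ContDiff ℝ 1 g) (hc : HasCompactSupport g) (v w : ℝ × ℝ) :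
    ∫ z, fderiv ℝ f z v * fderiv ℝ g z w = ∫ z, fderiv ℝ f z w * fderiv ℝ g z v := by
  have hf1 : ContDiff ℝ 1 f := hf.of_le (by norm_num)
  have hd (v : ℝ × ℝ) : ContDiff ℝ 1 fun z => fderiv ℝ f z v :=
    (hf.fderiv_right (m := 1) (by norm_num)).clm_apply contDiff_const
  have parts (v w : ℝ × ℝ) : ∫ z, fderiv ℝ f z v * fderiv ℝ g z w =
      -∫ z, fderiv ℝ (fun y => fderiv ℝ f y v) z w * g z :=
    integral_mul_fderiv_eq_neg_fderiv_mul_of_integrable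
      ((((hd v).continuous_fderiv_const_apply w).mul
        hg.continuous).integrable_of_hasCompactSupport hc.mul_left)
      (integrable_fderiv_mul_fderiv hf1 hg hc v w)
      (((hd v).continuous.mul hg.continuous).integrable_of_hasCompactSupport hc.mul_left)
      (fun x _ => (hd v).differentiable one_ne_zero x)
      (fun x _ => hg.differentiable one_ne_zero x)
  have second (z v w : ℝ × ℝ) :
      fderiv ℝ (fun y => fderiv ℝ f y v) z w = fderiv ℝ (fderiv ℝ f) z w v := by
    have : DifferentiableAt ℝ (fderiv ℝ f) z :=
      (hf.fderiv_right (m := 1) (by norm_num)).differentiable one_ne_zero z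
    rw [fderiv_clm_apply this (differentiableAt_const v)]
    simp
  rw [parts v w, parts w v]
  congr 2 with z
  rw [second, second, (hf.contDiffAt.isSymmSndFDerivAt (by simp)).eq]

theorem fderiv_conj_mul {f g : ℝ × ℝ → ℂ} {z : ℝ × ℝ} (hf : DifferentiableAt ℝ f z)
    (hg : DifferentiableAt ℝ g z) (v : ℝ × ℝ) :
    fderiv ℝ (fun y => conj (f y) * g y) z v =
      conj (fderiv ℝ f z v) * g z + conj (f z) * fderiv ℝ g z v := by
  have h := (conjCLE.hasFDerivAt.comp z hf.hasFDerivAt).mul hg.hasFDerivAt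
  refine (congrArg (fun L => L v) h.fderiv).trans ?_
  simp
  ring

theorem conj_fderiv_of_conj_eq {f g : ℝ × ℝ → ℂ} (h : ∀ z, conj (f z) = g z)
    {z : ℝ × ℝ} (hf : DifferentiableAt ℝ f z) (v : ℝ × ℝ) :
    conj (fderiv ℝ f z v) = fderiv ℝ g z v := by
  have := (conjCLE.hasFDerivAt.comp z hf.hasFDerivAt).fderiv
  have e : (conjCLE : ℂ → ℂ) ∘ f = g := funext h
  rw [e] at this
  rw [this]
  simp

/-- For Hermitian matrices, the two sides of the symmetry relation differ by a Poisson bracket of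
the Hamiltonian with the products of components, written here in terms of pointwise values. -/
theorem sum_conj_mul_sub_sum_conj_mul {n : ℕ} (ℏ : ℝ) (P Q N : Matrix (Fin n) (Fin n) ℂ)
    (hP : ∀ i j, conj (P i j) = P j i) (hQ : ∀ i j, conj (Q i j) = Q j i)
    (hN : ∀ i j, conj (N i j) = N j i) (u up uq v vp vq : Fin n → ℂ) :
    ∑ i, conj (I * (ℏ : ℂ) * (Q.mulVec up i - P.mulVec uq i) - N.mulVec u i) * v i =
      ∑ i, conj (u i) * (I * (ℏ : ℂ) * (Q.mulVec vp i - P.mulVec vq i) - N.mulVec v i) -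
      I * (ℏ : ℂ) * ∑ i, ∑ j, (Q i j * (conj (up i) * v j + conj (u i) * vp j) -
        P i j * (conj (uq i) * v j + conj (u i) * vq j)) := by
  have swap (M : Matrix (Fin n) (Fin n) ℂ) (hM : ∀ i j, conj (M i j) = M j i)
      (x y : Fin n → ℂ) : ∑ i, conj (M.mulVec x i) * y i = ∑ i, conj (x i) * M.mulVec y i := by
    simp only [mulVec, dotProduct, map_sum, map_mul, hM, Finset.sum_mul, Finset.mul_sum]
    rw [Finset.sum_comm]
    exact Finset.sum_congr rfl fun i _ => Finset.sum_congr rfl fun j _ => by ring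
  have expand (M : Matrix (Fin n) (Fin n) ℂ) (x y : Fin n → ℂ) :
      ∑ i, ∑ j, M i j * (conj (x i) * y j) = ∑ i, conj (x i) * M.mulVec y i := by
    simp only [mulVec, dotProduct, Finset.mul_sum]
    exact Finset.sum_congr rfl fun i _ => Finset.sum_congr rfl fun j _ => by ring
  have hl : ∑ i, conj (I * (ℏ : ℂ) * (Q.mulVec up i - P.mulVec uq i) - N.mulVec u i) * v i =
      -(I * (ℏ : ℂ)) * (∑ i, conj (Q.mulVec up i) * v i - ∑ i, conj (P.mulVec uq i) * v i) -
        ∑ i, conj (N.mulVec u i) * v i := by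
    rw [← Finset.sum_sub_distrib, Finset.mul_sum, ← Finset.sum_sub_distrib]
    refine Finset.sum_congr rfl fun i _ => ?_
    simp only [map_sub, map_mul, conj_I, conj_ofReal]
    ring
  have hr : ∑ i, conj (u i) * (I * (ℏ : ℂ) * (Q.mulVec vp i - P.mulVec vq i) - N.mulVec v i) =
      I * (ℏ : ℂ) * (∑ i, conj (u i) * Q.mulVec vp i - ∑ i, conj (u i) * P.mulVec vq i) -
        ∑ i, conj (u i) * N.mulVec v i := by
    rw [← Finset.sum_sub_distrib, Finset.mul_sum, ← Finset.sum_sub_distrib]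
    exact Finset.sum_congr rfl fun i _ => by ring
  simp only [hl, hr, swap Q hQ, swap P hP, swap N hN, mul_add, Finset.sum_sub_distrib,
    Finset.sum_add_distrib, expand]
  ring

/-- The hybrid Liouvillian (the generator of the quantum–classical
wave equation) is symmetric with respect to the `L²(ℝ², ℂⁿ)` inner product, i.e.
it is a Hermitian operator on the hybrid Hilbert space. -/
theorem hybridLiouvillian_symmetric {n : ℕ} (ℏ : ℝ) (hℏ : 0 < ℏ)
    (A : ℝ × ℝ → Matrix (Fin n) (Fin n) ℂ)
    (hA : ∀ i j, ContDiff ℝ (⊤ : ℕ∞) (fun z : ℝ × ℝ => A z i j))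
    (hAh : ∀ z, (A z).IsHermitian)
    (Υ₁ Υ₂ : ℝ × ℝ → Fin n → ℂ)
    (hΥ₁ : ContDiff ℝ (⊤ : ℕ∞) Υ₁) (hΥ₂ : ContDiff ℝ (⊤ : ℕ∞) Υ₂)
    (hc₁ : HasCompactSupport Υ₁) (hc₂ : HasCompactSupport Υ₂) :
    ∫ z : ℝ × ℝ, ∑ i, conj (hybridLiouvillian ℏ A Υ₁ z i) * Υ₂ z i
      = ∫ z : ℝ × ℝ, ∑ i, conj (Υ₁ z i) * hybridLiouvillian ℏ A Υ₂ z i := by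
  have hA1 (i j) : ContDiff ℝ 1 fun z => A z i j := (hA i j).of_le (by exact_mod_cast le_top)
  have hA2 (i j) : ContDiff ℝ 2 fun z => A z i j := contDiff_infty.1 (hA i j) 2
  have h₁ (i) : ContDiff ℝ 1 fun z => Υ₁ z i :=
    (contDiff_pi.1 hΥ₁ i).of_le (by exact_mod_cast le_top)
  have h₂ (i) : ContDiff ℝ 1 fun z => Υ₂ z i :=
    (contDiff_pi.1 hΥ₂ i).of_le (by exact_mod_cast le_top)
  have dA (i j z) : DifferentiableAt ℝ (fun z => A z i j) z :=
    (hA1 i j).differentiable one_ne_zero z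
  have d₁ (i z) : DifferentiableAt ℝ (fun z => Υ₁ z i) z := (h₁ i).differentiable one_ne_zero z
  have d₂ (i z) : DifferentiableAt ℝ (fun z => Υ₂ z i) z := (h₂ i).differentiable one_ne_zero z
  have hAq (z i j) : dqM A z i j = fderiv ℝ (fun z => A z i j) z (1, 0) :=
    deriv_slice_fst (dA i j z)
  have hAp (z i j) : dpM A z i j = fderiv ℝ (fun z => A z i j) z (0, 1) :=
    deriv_slice_snd (dA i j z)
  have h₁q (z i) : dqV Υ₁ z i = fderiv ℝ (fun z => Υ₁ z i) z (1, 0) := deriv_slice_fst (d₁ i z)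
  have h₁p (z i) : dpV Υ₁ z i = fderiv ℝ (fun z => Υ₁ z i) z (0, 1) := deriv_slice_snd (d₁ i z)
  have h₂q (z i) : dqV Υ₂ z i = fderiv ℝ (fun z => Υ₂ z i) z (1, 0) := deriv_slice_fst (d₂ i z)
  have h₂p (z i) : dpV Υ₂ z i = fderiv ℝ (fun z => Υ₂ z i) z (0, 1) := deriv_slice_snd (d₂ i z)
  have hconj (i j z) : conj (A z i j) = A z j i := (hAh z).apply j i
  have hq (z i j) : conj (dqM A z i j) = dqM A z j i := by
    rw [hAq, hAq, conj_fderiv_of_conj_eq (hconj i j) (dA i j z)]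
  have hp (z i j) : conj (dpM A z i j) = dpM A z j i := by
    rw [hAp, hAp, conj_fderiv_of_conj_eq (hconj i j) (dA i j z)]
  let G (i j : Fin n) (z : ℝ × ℝ) : ℂ := conj (Υ₁ z i) * Υ₂ z j
  have hG (i j) : ContDiff ℝ 1 (G i j) := (conjCLE.contDiff.comp (h₁ i)).mul (h₂ j)
  have c₁ (i) : HasCompactSupport fun z => conj (Υ₁ z i) :=
    hc₁.comp_left (g := fun v : Fin n → ℂ => conj (v i)) (map_zero _)
  have cG (i j) : HasCompactSupport (G i j) := (c₁ i).mul_right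
  let S (i j : Fin n) (z : ℝ × ℝ) : ℂ :=
    fderiv ℝ (fun z => A z i j) z (1, 0) * fderiv ℝ (G i j) z (0, 1) -
      fderiv ℝ (fun z => A z i j) z (0, 1) * fderiv ℝ (G i j) z (1, 0)
  have hS (i j) : Integrable (S i j) :=
    (integrable_fderiv_mul_fderiv (hA1 i j) (hG i j) (cG i j) _ _).sub
      (integrable_fderiv_mul_fderiv (hA1 i j) (hG i j) (cG i j) _ _)
  have hS0 (i j) : ∫ z, S i j z = 0 := by
    rw [integral_sub (integrable_fderiv_mul_fderiv (hA1 i j) (hG i j) (cG i j) _ _)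
      (integrable_fderiv_mul_fderiv (hA1 i j) (hG i j) (cG i j) _ _),
      integral_fderiv_mul_fderiv_comm (hA2 i j) (hG i j) (cG i j), sub_self]
  have key (z) : ∑ i, conj (hybridLiouvillian ℏ A Υ₁ z i) * Υ₂ z i =
      ∑ i, conj (Υ₁ z i) * hybridLiouvillian ℏ A Υ₂ z i -
        I * (ℏ : ℂ) * ∑ i, ∑ j, S i j z := by
    simp only [hybridLiouvillian]
    rw [sum_conj_mul_sub_sum_conj_mul ℏ (dpM A z) (dqM A z) ((z.2 : ℂ) • dpM A z - A z)
      (hp z) (hq z) (by simp [hp, hconj]) (Υ₁ z) (dpV Υ₁ z) (dqV Υ₁ z) (Υ₂ z) (dpV Υ₂ z)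
      (dqV Υ₂ z)]
    simp only [S, G, fderiv_conj_mul (d₁ _ z) (d₂ _ z), hAq, hAp, h₁q, h₁p, h₂q, h₂p]
  have hR : Integrable fun z => ∑ i, conj (Υ₁ z i) * hybridLiouvillian ℏ A Υ₂ z i := by
    refine integrable_finsetSum _ fun i _ => ?_
    have hs : HasCompactSupport fun z => conj (Υ₁ z i) * hybridLiouvillian ℏ A Υ₂ z i :=
      (c₁ i).mul_right
    refine Continuous.integrable_of_hasCompactSupport ?_ hs
    have cA (i j) : Continuous fun z => A z i j := (hA1 i j).continuous
    have cAd (i j v) : Continuous fun z => fderiv ℝ (fun z => A z i j) z v :=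
      (hA1 i j).continuous_fderiv_const_apply v
    have c₂ (i) : Continuous fun z => Υ₂ z i := (h₂ i).continuous
    have c₂d (i v) : Continuous fun z => fderiv ℝ (fun z => Υ₂ z i) z v :=
      (h₂ i).continuous_fderiv_const_apply v
    have c₁' : Continuous fun z => conj (Υ₁ z i) := continuous_conj.comp (h₁ i).continuous
    simp only [hybridLiouvillian, mulVec, dotProduct, Matrix.sub_apply, Matrix.smul_apply,
      smul_eq_mul, hAq, hAp, h₂q, h₂p]
    fun_prop
  have hT : Integrable fun z => ∑ i, ∑ j, S i j z :=
    integrable_finsetSum _ fun i _ => integrable_finsetSum _ fun j _ => hS i j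
  have hT0 : ∫ z, ∑ i, ∑ j, S i j z = 0 := by
    rw [integral_finsetSum _ fun i _ => integrable_finsetSum _ fun j _ => hS i j]
    refine Finset.sum_eq_zero fun i _ => ?_
    rw [integral_finsetSum _ fun j _ => hS i j]
    exact Finset.sum_eq_zero fun j _ => hS0 i j
  simp only [key]
  rw [integral_sub hR (hT.const_mul _), integral_const_mul, hT0, mul_zero, sub_zero]
end

section
/- Let ℏ > 0 and let Υ : ℝ² × ℝ → ℂ be smooth with compact support. Define the classical density ρ_c(z) := ∫_ℝ ( |Υ(z,x)|² + ∂_p( p |Υ(z,x)|² ) + ℏ Im {conj(Υ(·,x)), Υ(·,x)}(z) ) dx (brackets and derivatives in z = (q,p)) and the quantum density matrix kernel ρ̂(x,x') := ∫_{ℝ²} Υ(z,x) conj(Υ(z,x')) dz. Then total classical and quantum probabilities agree: ∫_{ℝ²} ρ_c(z) dz = ∫_ℝ ρ̂(x,x) dx = ∫_{ℝ²×ℝ} |Υ(z,x)|² dz dx. -/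
open Complex MeasureTheory ComplexConjugate

/-- The integral of a directional derivative of a compactly supported `C¹` function vanishes. -/
theorem integral_fderiv_apply_eq_zero {V : Type*} [NormedAddCommGroup V]
    [NormedSpace ℝ V] {E : Type*} [NormedAddCommGroup E]
    [NormedSpace ℝ E] [FiniteDimensional ℝ E] [MeasurableSpace E] [BorelSpace E]
    (μ : Measure E) [μ.IsAddHaarMeasure] {f : E → V} (hf : ContDiff ℝ 1 f)
    (hc : HasCompactSupport f) (v : E) : ∫ x, fderiv ℝ f x v ∂μ = 0 := by
  have h := integral_smul_fderiv_eq_neg_fderiv_smul_of_integrable (μ := μ) (𝕜 := ℝ)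
    (f := fun _ => (1 : ℝ)) (g := f) (v := v) (by simp)
    (by simpa using ((hf.continuous_fderiv one_ne_zero).clm_apply
      continuous_const).integrable_of_hasCompactSupport (hc.fderiv_apply (𝕜 := ℝ) v))
    (by simpa using hf.continuous.integrable_of_hasCompactSupport hc)
    (fun _ _ => differentiableAt_const _) (fun x _ => hf.differentiable one_ne_zero x)
  simpa using h

/-- The integrand of the integrated Poisson bracket of `conj F` and `F` is a divergence, so its
integral vanishes. -/
theorem integral_conj_fderiv_mul_fderiv_sub_eq_zero {E : Type*} [NormedAddCommGroup E]
    [NormedSpace ℝ E] [FiniteDimensional ℝ E] [MeasurableSpace E] [BorelSpace E]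
    (μ : Measure E) [μ.IsAddHaarMeasure] {F : E → ℂ} (hF : ContDiff ℝ 2 F)
    (hc : HasCompactSupport F) (u v : E) :
    ∫ x, (conj (fderiv ℝ F x u) * fderiv ℝ F x v - conj (fderiv ℝ F x v) * fderiv ℝ F x u) ∂μ
      = 0 := by
  have hD : ContDiff ℝ 1 (fderiv ℝ F) := hF.fderiv_right (by norm_num)
  have hcF : ∀ w, ContDiff ℝ 1 (fun x => conj (fderiv ℝ F x w)) := fun w =>
    conjCLE.contDiff.comp (hD.clm_apply contDiff_const)
  have hP : ∀ w, ContDiff ℝ 1 (fun x => conj (fderiv ℝ F x w) * F x) := fun w =>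
    (hcF w).mul (hF.of_le one_le_two)
  have hPc : ∀ w, HasCompactSupport (fun x => conj (fderiv ℝ F x w) * F x) := fun w => hc.mul_left
  have hderiv : ∀ a b x, fderiv ℝ (fun x => conj (fderiv ℝ F x a) * F x) x b
      = conj (fderiv ℝ F x a) * fderiv ℝ F x b
        + conj (fderiv ℝ (fderiv ℝ F) x b a) * F x := by
    intro a b x
    have h1 : HasFDerivAt (fun x => fderiv ℝ F x a) _ x :=
      ((hD.differentiable one_ne_zero x).hasFDerivAt).clm_apply (hasFDerivAt_const a x)
    have h2 : HasFDerivAt (fun x => conj (fderiv ℝ F x a)) _ x :=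
      (conjCLE.hasFDerivAt).comp x h1
    have h3 := h2.mul (hF.differentiable two_ne_zero x).hasFDerivAt
    rw [show (fun x => conj (fderiv ℝ F x a) * F x) = (fun x => conj (fderiv ℝ F x a)) * F from rfl,
      h3.fderiv]
    simp [mul_comm]
  have hint : ∀ a b, Integrable
      (fun x => fderiv ℝ (fun x => conj (fderiv ℝ F x a) * F x) x b) μ := fun a b =>
    (((hP a).continuous_fderiv one_ne_zero).clm_apply
      continuous_const).integrable_of_hasCompactSupport ((hPc a).fderiv_apply (𝕜 := ℝ) b)
  have hsymm : ∀ x, fderiv ℝ (fderiv ℝ F) x u v = fderiv ℝ (fderiv ℝ F) x v u := fun x =>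
    (hF.contDiffAt.isSymmSndFDerivAt (by simp)) u v
  calc _ = ∫ x, (fderiv ℝ (fun x => conj (fderiv ℝ F x u) * F x) x v
        - fderiv ℝ (fun x => conj (fderiv ℝ F x v) * F x) x u) ∂μ := by
        congr 1; ext x; rw [hderiv, hderiv, hsymm]; ring
    _ = 0 := by
        rw [integral_sub (hint u v) (hint v u), integral_fderiv_apply_eq_zero μ (hP u) (hPc u),
          integral_fderiv_apply_eq_zero μ (hP v) (hPc v), sub_zero]

theorem hasDerivAt_slice_q {V : Type*} [NormedAddCommGroup V] [NormedSpace ℝ V]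
    {F : (ℝ × ℝ) × ℝ → V} (hF : Differentiable ℝ F) (z : ℝ × ℝ) (x : ℝ) :
    HasDerivAt (fun q => F ((q, z.2), x)) (fderiv ℝ F (z, x) ((1, 0), 0)) z.1 :=
  (hF (z, x)).hasFDerivAt.comp_hasDerivAt z.1
    (((hasDerivAt_id z.1).prodMk (hasDerivAt_const z.1 z.2)).prodMk (hasDerivAt_const z.1 x))

theorem hasDerivAt_slice_p {V : Type*} [NormedAddCommGroup V] [NormedSpace ℝ V]
    {F : (ℝ × ℝ) × ℝ → V} (hF : Differentiable ℝ F) (z : ℝ × ℝ) (x : ℝ) :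
    HasDerivAt (fun p => F ((z.1, p), x)) (fderiv ℝ F (z, x) ((0, 1), 0)) z.2 :=
  (hF (z, x)).hasFDerivAt.comp_hasDerivAt z.2
    (((hasDerivAt_const z.2 z.1).prodMk (hasDerivAt_id z.2)).prodMk (hasDerivAt_const z.2 x))

/-- The bracket of `conj Υ` and `Υ` in terms of the total derivative of `Υ`. -/
theorem pbC_conj_slice {F : (ℝ × ℝ) × ℝ → ℂ} (hF : Differentiable ℝ F) (z : ℝ × ℝ) (x : ℝ) :
    pbC (fun w => conj (F (w, x))) (fun w => F (w, x)) z
      = conj (fderiv ℝ F (z, x) ((1, 0), 0)) * fderiv ℝ F (z, x) ((0, 1), 0)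
        - conj (fderiv ℝ F (z, x) ((0, 1), 0)) * fderiv ℝ F (z, x) ((1, 0), 0) := by
  have hq := hasDerivAt_slice_q hF z x
  have hp := hasDerivAt_slice_p hF z x
  have hq' := hq.star
  have hp' := hp.star
  simp only [← starRingEnd_apply] at hq' hp'
  simp only [pbC, dq, dp]
  rw [hq.deriv, hp.deriv, hq'.deriv, hp'.deriv]

/-- For a hybrid quantum–classical wavefunction `Υ`, the total
classical probability `∫ ρ_c`, the total quantum probability `∫ ρ̂(x,x) dx`, and
the squared `L²` norm of `Υ` all agree. -/
theorem hybrid_total_probabilities_agree (ℏ : ℝ) (hℏ : 0 < ℏ)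
    (Υ : ℝ × ℝ → ℝ → ℂ)
    (hΥ : ContDiff ℝ (⊤ : ℕ∞) (fun zx : (ℝ × ℝ) × ℝ => Υ zx.1 zx.2))
    (hc : HasCompactSupport (fun zx : (ℝ × ℝ) × ℝ => Υ zx.1 zx.2))
    (ρc : ℝ × ℝ → ℝ)
    (hρc : ∀ z, ρc z = ∫ x : ℝ,
        (Complex.normSq (Υ z x)
          + dpR (fun w => w.2 * Complex.normSq (Υ w x)) z
          + ℏ * (pbC (fun w => conj (Υ w x)) (fun w => Υ w x) z).im))
    (ρhat : ℝ → ℝ → ℂ)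
    (hρhat : ∀ x x', ρhat x x' = ∫ z : ℝ × ℝ, Υ z x * conj (Υ z x')) :
    (∫ z : ℝ × ℝ, ρc z) = (∫ zx : (ℝ × ℝ) × ℝ, Complex.normSq (Υ zx.1 zx.2))
    ∧ (∫ x : ℝ, ρhat x x)
        = ((∫ zx : (ℝ × ℝ) × ℝ, Complex.normSq (Υ zx.1 zx.2) : ℝ) : ℂ) := by
  have : (volume : Measure (ℝ × ℝ)).IsAddHaarMeasure := Measure.prod.instIsAddHaarMeasure _ _
  have : (volume : Measure ((ℝ × ℝ) × ℝ)).IsAddHaarMeasure :=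
    Measure.prod.instIsAddHaarMeasure _ _
  set F : (ℝ × ℝ) × ℝ → ℂ := fun zx => Υ zx.1 zx.2 with hFdef
  have hF2 : ContDiff ℝ 2 F := hΥ.of_le (WithTop.coe_le_coe.2 le_top)
  have hF1 : ContDiff ℝ 1 F := hF2.of_le one_le_two
  have hFd : Differentiable ℝ F := hF1.differentiable one_ne_zero
  have hN : ContDiff ℝ 1 (fun w => normSq (F w)) := by
    simp only [normSq_eq_norm_sq]
    exact hF1.norm_sq ℝ
  have hNc : HasCompactSupport (fun w => normSq (F w)) := hc.comp_left (map_zero normSq)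
  have hNi : Integrable (fun w => normSq (F w)) :=
    hN.continuous.integrable_of_hasCompactSupport hNc
  set M : (ℝ × ℝ) × ℝ → ℝ := fun w => w.1.2 * normSq (F w) with hMdef
  have hM : ContDiff ℝ 1 M := (contDiff_snd.comp contDiff_fst).mul hN
  have hMc : HasCompactSupport M := hNc.mul_left
  have hMi : Integrable (fun w => fderiv ℝ M w ((0, 1), 0)) :=
    ((hM.continuous_fderiv one_ne_zero).clm_apply
      continuous_const).integrable_of_hasCompactSupport (hMc.fderiv_apply (𝕜 := ℝ) _)
  have hM0 : ∫ w, fderiv ℝ M w ((0, 1), 0) = 0 :=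
    integral_fderiv_apply_eq_zero volume hM hMc _
  set B : (ℝ × ℝ) × ℝ → ℂ := fun w =>
    conj (fderiv ℝ F w ((1, 0), 0)) * fderiv ℝ F w ((0, 1), 0)
      - conj (fderiv ℝ F w ((0, 1), 0)) * fderiv ℝ F w ((1, 0), 0) with hBdef
  have hDc : ∀ v, Continuous (fun w => fderiv ℝ F w v) := fun v =>
    (hF1.continuous_fderiv one_ne_zero).clm_apply continuous_const
  have hDs : ∀ v, HasCompactSupport (fun w => fderiv ℝ F w v) := fun v =>
    hc.fderiv_apply (𝕜 := ℝ) v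
  have hBi : Integrable B :=
    (((continuous_conj.comp (hDc _)).mul (hDc _)).integrable_of_hasCompactSupport
      (hDs _).mul_left).sub
    (((continuous_conj.comp (hDc _)).mul (hDc _)).integrable_of_hasCompactSupport
      (hDs _).mul_left)
  have hB0 : ∫ w, (B w).im = 0 := by
    have h := integral_im hBi
    simp only [RCLike.im_to_complex] at h
    rw [h, hBdef, integral_conj_fderiv_mul_fderiv_sub_eq_zero volume hF2 hc, zero_im]
  have hBim : Integrable (fun w => ℏ * (B w).im) := hBi.im.const_mul ℏ
  constructor
  · have hρ : ∀ z, ρc z = ∫ x, (normSq (F (z, x)) + fderiv ℝ M (z, x) ((0, 1), 0)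
        + ℏ * (B (z, x)).im) := by
      intro z
      rw [hρc]
      congr 1
      ext x
      congr 2
      · exact (hasDerivAt_slice_p (hM.differentiable one_ne_zero) z x).deriv
      · exact congrArg im (pbC_conj_slice hFd z x)
    simp only [hρ]
    rw [← integral_prod (fun w => normSq (F w) + fderiv ℝ M w ((0, 1), 0) + ℏ * (B w).im)
      ((hNi.add hMi).add hBim), ← Measure.volume_eq_prod,
      integral_add (f := fun w => normSq (F w) + fderiv ℝ M w ((0, 1), 0)) (hNi.add hMi) hBim,
      integral_add hNi hMi, hM0, integral_const_mul, hB0,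
      add_zero, mul_zero, add_zero]
  · have hρ : ∀ x, ρhat x x = ∫ z, ((normSq (F (z, x)) : ℝ) : ℂ) := by
      intro x
      rw [hρhat]
      congr 1
      ext z
      exact mul_conj _
    simp only [hρ]
    rw [← integral_prod_symm (fun w => ((normSq (F w) : ℝ) : ℂ)) hNi.ofReal,
      ← Measure.volume_eq_prod]
    exact integral_ofReal
end
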